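/- arXiv:2403.19324 — 2 statements merged into one kernel-verified Lean document; each statement's English description precedes it below -/
import Mathlib

section
/- Let N ≥ 1 and j ≥ 1. The map E_j is a topological embedding of ℝ^N into ℝ^{D(N,j)}; consequently, its image C^{(N,j)} = E_j '' (Fin N → ℝ), equipped with the subspace topology, is homeomorphic to Fin N → ℝ. -/
/-- The index set of nonconstant monomials of degree between 1 and `j` in `N` variables. -/
def Dset (N j : ℕ) : Set (Fin N →₀ ℕ) := {d | 1 ≤ ∑ i, d i ∧ ∑ i, d i ≤ j}

/-- The overparameterized monomial map `E_j`, sending `x` to the vector of all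
nonconstant monomials of degree at most `j` evaluated at `x`. -/
noncomputable def Emap (N j : ℕ) (x : Fin N → ℝ) : Dset N j → ℝ :=
  fun d => ∏ i, x i ^ ((d : Fin N →₀ ℕ) i)

theorem single_mem_Dset (N j : ℕ) (hj : 1 ≤ j) (i : Fin N) :
    (Finsupp.single i 1 : Fin N →₀ ℕ) ∈ Dset N j := by
  have h : ∑ k, (Finsupp.single i 1 : Fin N →₀ ℕ) k = 1 := by
    simp [Finsupp.single_apply]
  exact ⟨by rw [h], by rw [h]; exact hj⟩

instance DsetFinite (N j : ℕ) : Finite (Dset N j) := by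
  refine Finite.of_injective
    (fun d : Dset N j => (fun i => (⟨(d : Fin N →₀ ℕ) i,
      Nat.lt_succ_of_le (le_trans
        (Finset.single_le_sum (fun k _ => Nat.zero_le ((d : Fin N →₀ ℕ) k)) (Finset.mem_univ i))
        d.2.2)⟩ : Fin (j + 1))) : Dset N j → (Fin N → Fin (j + 1))) ?_
  intro d e h
  apply Subtype.ext
  apply Finsupp.ext
  intro i
  simpa using congrFun h i

noncomputable instance (N j : ℕ) : Fintype (Dset N j) := Fintype.ofFinite _

theorem Emap_single (N j : ℕ) (hj : 1 ≤ j) (x : Fin N → ℝ) (i : Fin N) :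
    Emap N j x ⟨Finsupp.single i 1, single_mem_Dset N j hj i⟩ = x i := by
  simp [Emap, Finsupp.single_apply, pow_ite]

theorem continuous_Emap (N j : ℕ) : Continuous (Emap N j) := by
  unfold Emap
  fun_prop

/-- Projection onto the degree-one coordinates is a continuous left inverse of `E_j`. -/
theorem isEmbedding_Emap (N j : ℕ) (hj : 1 ≤ j) : Topology.IsEmbedding (Emap N j) :=
  Function.LeftInverse.isEmbedding
    (f := fun (c : Dset N j → ℝ) i => c ⟨Finsupp.single i 1, single_mem_Dset N j hj i⟩)
    (fun x => funext (Emap_single N j hj x)) (by fun_prop) (continuous_Emap N j)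

/-- The overparameterized monomial map `E_j` is a topological embedding of `ℝ^N`
into `ℝ^{D(N,j)}`; consequently its image, the monomial constraint manifold
`C^{(N,j)}`, equipped with the subspace topology, is homeomorphic to `ℝ^N`. -/
theorem Emap_isEmbedding_and_image_homeomorph (N j : ℕ) (hN : 1 ≤ N) (hj : 1 ≤ j) :
    Topology.IsEmbedding (Emap N j) ∧
      Nonempty ((Emap N j '' Set.univ) ≃ₜ (Fin N → ℝ)) := by
  have h := isEmbedding_Emap N j hj
  refine ⟨h, ?_⟩
  rw [Set.image_univ]
  exact ⟨h.toHomeomorph.symm⟩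
end

section
/- Let N ≥ 1 and j ≥ 1. There exist a continuous linear map A₀ : (Fin N → ℝ) →L[ℝ] (D(N,j) → ℝ) and a linear map L : (D(N,j) → ℝ) →ₗ[ℝ] ((Fin N → ℝ) →L[ℝ] (D(N,j) → ℝ)) such that for every x : Fin N → ℝ, fderiv ℝ E_j x = A₀ + L (E_j x). -/
/-- The Jacobian matrix entries of a monomial are monomials with one exponent lowered. -/
theorem hasFDerivAt_prod_pow {ι : Type*} [Fintype ι] [DecidableEq ι] (d : ι →₀ ℕ) (x : ι → ℝ) :
    HasFDerivAt (fun y : ι → ℝ => ∏ i, y i ^ d i)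
      (∑ i, ((d i : ℝ) * ∏ k, x k ^ (d - Finsupp.single i 1 : ι →₀ ℕ) k) •
        (ContinuousLinearMap.proj i : (ι → ℝ) →L[ℝ] ℝ)) x := by
  have h := HasFDerivAt.finsetProd (u := Finset.univ) (x := x) fun i _ =>
    ((ContinuousLinearMap.proj i : (ι → ℝ) →L[ℝ] ℝ).hasFDerivAt (x := x)).pow (d i)
  refine h.congr_fderiv (Finset.sum_congr rfl fun i _ => ?_)
  rw [smul_smul, ← Finset.mul_prod_erase Finset.univ _ (Finset.mem_univ i)]
  have he : ∏ k ∈ Finset.univ.erase i, x k ^ (d - Finsupp.single i 1 : ι →₀ ℕ) k =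
      ∏ k ∈ Finset.univ.erase i, x k ^ d k :=
    Finset.prod_congr rfl fun k hk => by
      simp [(Finset.ne_of_mem_erase hk).symm]
  rw [he]
  congr 1
  simp
  ring

open Classical in
/-- The coordinate functional reading off the monomial with exponent `e`, or zero if `e` is not
one of the exponents in `Dset N j`. -/
noncomputable def monomialCoord (N j : ℕ) (e : Fin N →₀ ℕ) : (Dset N j → ℝ) →ₗ[ℝ] ℝ :=
  if h : e ∈ Dset N j then LinearMap.proj ⟨e, h⟩ else 0

open Classical in
/-- A monomial of degree at most `j` is an affine function of the nonconstant ones. -/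
theorem prod_pow_eq_add_monomialCoord {N j : ℕ} {e : Fin N →₀ ℕ} (he : ∑ i, e i ≤ j)
    (x : Fin N → ℝ) :
    ∏ i, x i ^ e i = (if e = 0 then 1 else 0) + monomialCoord N j e (Emap N j x) := by
  by_cases h0 : e = 0
  · subst h0
    have h : (0 : Fin N →₀ ℕ) ∉ Dset N j := by simp [Dset]
    simp [monomialCoord, h]
  · have h : e ∈ Dset N j := by
      refine ⟨Nat.one_le_iff_ne_zero.2 fun hs => h0 (Finsupp.ext fun i => ?_), he⟩
      exact Finset.sum_eq_zero_iff.1 hs i (Finset.mem_univ i)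
    simp [monomialCoord, h, h0, Emap]

/-- The Jacobian of the overparameterized monomial map `E_j` at a point `x` is an
affine (constant plus linear) function of the monomial coordinates `E_j x`:
there are a fixed continuous linear map `A₀` and a linear map `L` such that
`fderiv ℝ E_j x = A₀ + L (E_j x)` for every `x`. -/
theorem fderiv_Emap_affine_in_monomials (N j : ℕ) (hN : 1 ≤ N) (hj : 1 ≤ j) :
    ∃ (A₀ : (Fin N → ℝ) →L[ℝ] (Dset N j → ℝ))
      (L : (Dset N j → ℝ) →ₗ[ℝ] ((Fin N → ℝ) →L[ℝ] (Dset N j → ℝ))),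
      ∀ x : Fin N → ℝ, fderiv ℝ (Emap N j) x = A₀ + L (Emap N j x) := by
  classical
  refine ⟨ContinuousLinearMap.pi fun d => ∑ i,
      ((d.1 i : ℝ) * (if d.1 - Finsupp.single i 1 = 0 then 1 else 0)) •
        ContinuousLinearMap.proj i,
    { toFun := fun v => ContinuousLinearMap.pi fun d => ∑ i,
        ((d.1 i : ℝ) * monomialCoord N j (d.1 - Finsupp.single i 1) v) •
          ContinuousLinearMap.proj i
      map_add' := fun v w => by
        ext y d
        simp [mul_add, add_mul, Finset.sum_add_distrib]
      map_smul' := fun c v => by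
        ext y d
        simp [Finset.mul_sum, mul_assoc, mul_left_comm] }, fun x => ?_⟩
  have hle (d : Dset N j) (i : Fin N) : ∑ k, (d.1 - Finsupp.single i 1 : Fin N →₀ ℕ) k ≤ j :=
    (Finset.sum_le_sum fun k _ => by simp).trans d.2.2
  have h : HasFDerivAt (Emap N j) (ContinuousLinearMap.pi fun d => _) x :=
    hasFDerivAt_pi.2 fun d : Dset N j => hasFDerivAt_prod_pow d.1 x
  rw [h.fderiv]
  ext1 y
  funext d
  simp only [ContinuousLinearMap.pi_apply, add_apply, Pi.add_apply,
    LinearMap.coe_mk, AddHom.coe_mk, sum_apply, smul_apply,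
    prod_pow_eq_add_monomialCoord (hle d _), mul_add, add_smul, Finset.sum_add_distrib]
end
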